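/- s(5) = 8: the minimum number of squares in a squared tiling of the 5×5 square by strictly smaller integer squares equals 8. -/

import Mathlib

/-- A squared tiling of the `n × n` square: a finite set of triples `(x, y, h)`
representing an `h × h` square with upper-left corner at cell `(x, y)`,
where `1 ≤ h ≤ n - 1`, the square lies inside the board, and every cell
`(i, j)` with `i, j < n` is covered by exactly one square of the tiling. -/
def IsSquaredTiling (n : ℕ) (T : Finset (ℕ × ℕ × ℕ)) : Prop :=
  (∀ t ∈ T, 1 ≤ t.2.2 ∧ t.2.2 ≤ n - 1 ∧ t.1 + t.2.2 ≤ n ∧ t.2.1 + t.2.2 ≤ n) ∧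
  (∀ i j : ℕ, i < n → j < n →
    ∃! t : ℕ × ℕ × ℕ, t ∈ T ∧
      t.1 ≤ i ∧ i < t.1 + t.2.2 ∧ t.2.1 ≤ j ∧ j < t.2.1 + t.2.2)

/-- `s n` is the minimum number of squares in a squared tiling of the
`n × n` square. -/
noncomputable def s (n : ℕ) : ℕ :=
  sInf {k | ∃ T : Finset (ℕ × ℕ × ℕ), IsSquaredTiling n T ∧ T.card = k}

/-- The square `t` covers the cell `c`. -/
def cov (t : ℕ × ℕ × ℕ) (c : ℕ × ℕ) : Bool :=
  decide (t.1 ≤ c.1) && decide (c.1 < t.1 + t.2.2) &&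
    decide (t.2.1 ≤ c.2) && decide (c.2 < t.2.1 + t.2.2)

/-- The cells of the board. -/
def cells : Finset (ℕ × ℕ) := Finset.range 5 ×ˢ Finset.range 5

/-- Signed weight of a cell, depending on the square `B` covering the centre. -/
def wt (B : ℕ × ℕ × ℕ) (c : ℕ × ℕ) : ℤ :=
  if B.2.2 ≤ 2 then (if c.1 % 2 = 0 ∧ c.2 % 2 = 0 then 1 else 0)
  else if cov B c then (if c = (2, 2) then 1 else 0)
  else if B.2.2 = 3 ∧ c.1 % 2 = 1 ∧ c.2 % 2 = 1 then -2 else 1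

/-- Total weight of a square. -/
def sqw (B t : ℕ × ℕ × ℕ) : ℤ := ∑ c ∈ cells, if cov t c then wt B c else 0

/-- Triples with small entries. -/
def cand : Finset (ℕ × ℕ × ℕ) := Finset.range 5 ×ˢ Finset.range 5 ×ˢ Finset.range 5

/-- Squares lying in the board. -/
def vld (t : ℕ × ℕ × ℕ) : Bool := decide (t.1 + t.2.2 ≤ 5) && decide (t.2.1 + t.2.2 ≤ 5)

/-- Squares lying in the board that cover the centre. -/
def ctr : Finset (ℕ × ℕ × ℕ) := cand.filter fun t => vld t && cov t (2, 2)

/-- Squares lying in the board. -/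
def sqs : Finset (ℕ × ℕ × ℕ) := cand.filter fun t => vld t

/-- Two squares share a cell. -/
def meets (B t : ℕ × ℕ × ℕ) : Prop := ∃ c ∈ cells, (cov B c && cov t c) = true

instance (B t : ℕ × ℕ × ℕ) : Decidable (meets B t) := by unfold meets; infer_instance

lemma total_ge : ∀ B ∈ ctr, 8 ≤ ∑ c ∈ cells, wt B c := by
  decide +kernel

lemma sqw_le : ∀ B ∈ ctr, ∀ t ∈ sqs, t = B ∨ ¬ meets B t → sqw B t ≤ 1 := by
  decide +kernel

lemma cov_iff (t : ℕ × ℕ × ℕ) (c : ℕ × ℕ) : cov t c = true ↔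
    (t.1 ≤ c.1 ∧ c.1 < t.1 + t.2.2 ∧ t.2.1 ≤ c.2 ∧ c.2 < t.2.1 + t.2.2) := by
  simp [cov, and_assoc]

lemma lower (T : Finset (ℕ × ℕ × ℕ)) (hT : IsSquaredTiling 5 T) : 8 ≤ T.card := by
  obtain ⟨h1, h2⟩ := hT
  have h3 : ∀ c ∈ cells, ∃ t ∈ T, cov t c = true ∧ ∀ u ∈ T, cov u c = true → u = t := by
    intro c hc
    simp only [cells, Finset.mem_product, Finset.mem_range] at hc
    obtain ⟨t, ⟨ht, hct⟩, hu⟩ := h2 c.1 c.2 hc.1 hc.2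
    exact ⟨t, ht, (cov_iff t c).2 hct, fun u hu' hcu => hu u ⟨hu', (cov_iff u c).1 hcu⟩⟩
  obtain ⟨B, hB, hBc, -⟩ := h3 (2, 2) (by simp [cells])
  have hsum : ∑ c ∈ cells, wt B c = ∑ t ∈ T, sqw B t := by
    unfold sqw
    rw [Finset.sum_comm]
    refine Finset.sum_congr rfl fun c hc => ?_
    obtain ⟨t, ht, hct, hu⟩ := h3 c hc
    rw [Finset.sum_eq_single_of_mem t ht]
    · simp [hct]
    · intro u hu' hne
      rw [if_neg]
      exact fun hcu => hne (hu u hu' hcu)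
  have hv : ∀ t ∈ T, t ∈ cand ∧ vld t = true := by
    intro t ht
    have := h1 t ht
    simp only [cand, vld, Finset.mem_product, Finset.mem_range, Bool.and_eq_true,
      decide_eq_true_eq]
    omega
  have hBm : B ∈ ctr := by
    have := hv B hB
    simp [ctr, this.1, this.2, hBc]
  have e1 := total_ge B hBm
  have e2 : ∑ t ∈ T, sqw B t ≤ ∑ t ∈ T, (1 : ℤ) := by
    refine Finset.sum_le_sum fun t ht => ?_
    refine sqw_le B hBm t (by simp [sqs, hv t ht]) ?_
    by_cases heq : t = B
    · exact Or.inl heq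
    · right
      rintro ⟨c, hc, hcc⟩
      rw [Bool.and_eq_true] at hcc
      obtain ⟨_, _, _, hu⟩ := h3 c hc
      exact heq ((hu _ ht hcc.2).trans (hu _ hB hcc.1).symm)
  simp only [Finset.sum_const, nsmul_eq_mul, mul_one] at e2
  omega

/-- An explicit tiling with eight squares. -/
def T8 : Finset (ℕ × ℕ × ℕ) :=
  {(0, 0, 3), (3, 0, 2), (0, 3, 2), (3, 3, 2), (2, 3, 1), (2, 4, 1), (3, 2, 1), (4, 2, 1)}

lemma T8_cover : ∀ i < 5, ∀ j < 5, ∃ t ∈ T8, cov t (i, j) = true ∧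
    ∀ u ∈ T8, cov u (i, j) = true → u = t := by
  decide +kernel

lemma T8_tiling : IsSquaredTiling 5 T8 := by
  refine ⟨by decide +kernel, fun i j hi hj => ?_⟩
  obtain ⟨t, ht, hc, hu⟩ := T8_cover i hi j hj
  exact ⟨t, ⟨ht, (cov_iff t (i, j)).1 hc⟩, fun u hu' => hu u hu'.1 ((cov_iff u (i, j)).2 hu'.2)⟩

theorem s_5 : s 5 = 8 := by
  apply le_antisymm
  · exact Nat.sInf_le ⟨T8, T8_tiling, by decide +kernel⟩
  · refine le_csInf ⟨8, T8, T8_tiling, by decide +kernel⟩ ?_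
    rintro k ⟨T, hT, rfl⟩
    exact lower T hT
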